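/- Let d ≥ 1 be an integer, β > d/2 + 1, and let V ∈ C²(ℝ^d) be positive, α-strongly convex (∇²V ⪰ α I_d, α > 0), L-gradient Lipschitz (∇²V ⪯ L I_d), and attain its global minimum at 0. Then for every r ∈ (0, β − d/2 − 1): (i) ∫_{ℝ^d} V(x) π_β(x) dx ≤ (L/α)^{(d/2)/(β−d/2−r)} · V(0) · (Γ(β)Γ(r)/(Γ(d/2+r)Γ(β−d/2)))^{1/(β−d/2−r)}; and (ii) ∫_{ℝ^d} |∇V(x)|² π_β(x) dx ≤ (dL/(β−1)) · (L/α)^{(d/2)/(β−d/2−r)} · V(0) · (Γ(β)Γ(r)/(Γ(d/2+r)Γ(β−d/2)))^{1/(β−d/2−r)}. -/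

import Mathlib

open MeasureTheory Real Matrix

/-- The Hessian matrix of `f : ℝ^d → ℝ` at `x`. -/
noncomputable def hessianMatrix {d : ℕ} (f : EuclideanSpace ℝ (Fin d) → ℝ)
    (x : EuclideanSpace ℝ (Fin d)) : Matrix (Fin d) (Fin d) ℝ :=
  Matrix.of fun i j =>
    iteratedFDeriv ℝ 2 f x ![EuclideanSpace.single i 1, EuclideanSpace.single j 1]

lemma taylor_one (φ φ' φ'' : ℝ → ℝ) (h1 : ∀ t, HasDerivAt φ (φ' t) t)
    (h2 : ∀ t, HasDerivAt φ' (φ'' t) t) (m : ℝ) (hm : ∀ t, m ≤ φ'' t) :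
    φ 0 + φ' 0 + m / 2 ≤ φ 1 := by
  have hd1 : ∀ t, HasDerivAt (fun t => φ' t - m * t) (φ'' t - m) t := fun t => by
    convert! (h2 t).sub ((hasDerivAt_id t).const_mul m) using 1; simp
  have mono1 : Monotone (fun t => φ' t - m * t) :=
    monotone_of_deriv_nonneg (fun t => (hd1 t).differentiableAt)
      (fun t => by rw [(hd1 t).deriv]; linarith [hm t])
  have hd2 : ∀ t, HasDerivAt (fun t => φ t - m / 2 * t ^ 2 - φ' 0 * t)
      (φ' t - m * t - φ' 0) t := fun t => by
    have := ((h1 t).sub ((hasDerivAt_pow 2 t).const_mul (m / 2))).sub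
      ((hasDerivAt_id t).const_mul (φ' 0))
    convert! this using 1
    simp; ring
  have mono2 : MonotoneOn (fun t => φ t - m / 2 * t ^ 2 - φ' 0 * t) (Set.Icc 0 1) := by
    refine monotoneOn_of_deriv_nonneg (convex_Icc 0 1)
      (fun t _ => (hd2 t).continuousAt.continuousWithinAt)
      (fun t _ => (hd2 t).differentiableAt.differentiableWithinAt) ?_
    intro t ht
    rw [interior_Icc] at ht
    rw [(hd2 t).deriv]
    have := mono1 ht.1.le
    simp at this
    linarith
  have := mono2 (Set.left_mem_Icc.2 zero_le_one) (Set.right_mem_Icc.2 zero_le_one) zero_le_one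
  simp at this
  linarith

lemma hess_quad {d : ℕ} (V : EuclideanSpace ℝ (Fin d) → ℝ) (x u : EuclideanSpace ℝ (Fin d)) :
    fderiv ℝ (fderiv ℝ V) x u u = u.ofLp ⬝ᵥ (hessianMatrix V x *ᵥ u.ofLp) := by
  have hu : u = ∑ i, u i • EuclideanSpace.single i (1 : ℝ) := by
    ext j
    simp [Finset.sum_apply, Pi.single_apply]
  conv_lhs => rw [hu]
  simp only [map_sum, map_smul, _root_.sum_apply, _root_.smul_apply,
    dotProduct, mulVec, hessianMatrix, iteratedFDeriv_two_apply, Matrix.of_apply, smul_eq_mul]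
  simp only [Matrix.cons_val_zero, Matrix.cons_val_one, Finset.mul_sum]
  rw [Finset.sum_comm]
  refine Finset.sum_congr rfl fun i _ => Finset.sum_congr rfl fun j _ => ?_
  ring

lemma dot_self_eq {d : ℕ} (u : EuclideanSpace ℝ (Fin d)) : u.ofLp ⬝ᵥ u.ofLp = ‖u‖ ^ 2 := by
  rw [EuclideanSpace.norm_sq_eq]
  simp [dotProduct, sq]

lemma hess_lower {d : ℕ} (V : EuclideanSpace ℝ (Fin d) → ℝ) (α : ℝ)
    (h : ∀ x, (hessianMatrix V x - α • 1).PosSemidef) (x u : EuclideanSpace ℝ (Fin d)) :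
    α * ‖u‖ ^ 2 ≤ fderiv ℝ (fderiv ℝ V) x u u := by
  have := (h x).dotProduct_mulVec_nonneg u.ofLp
  rw [hess_quad, ← dot_self_eq]
  simp [Matrix.sub_mulVec, dotProduct_sub, Matrix.smul_mulVec] at this
  linarith

lemma hess_upper {d : ℕ} (V : EuclideanSpace ℝ (Fin d) → ℝ) (L : ℝ)
    (h : ∀ x, ((L • 1 : Matrix (Fin d) (Fin d) ℝ) - hessianMatrix V x).PosSemidef)
    (x u : EuclideanSpace ℝ (Fin d)) :
    fderiv ℝ (fderiv ℝ V) x u u ≤ L * ‖u‖ ^ 2 := by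
  have := (h x).dotProduct_mulVec_nonneg u.ofLp
  rw [hess_quad, ← dot_self_eq]
  simp [Matrix.sub_mulVec, dotProduct_sub, Matrix.smul_mulVec] at this
  linarith

lemma line_derivs {d : ℕ} (V : EuclideanSpace ℝ (Fin d) → ℝ) (hV : ContDiff ℝ 2 V)
    (x u : EuclideanSpace ℝ (Fin d)) :
    (∀ t : ℝ, HasDerivAt (fun t : ℝ => V (x + t • u)) (fderiv ℝ V (x + t • u) u) t) ∧
    (∀ t : ℝ, HasDerivAt (fun t : ℝ => fderiv ℝ V (x + t • u) u)
      (fderiv ℝ (fderiv ℝ V) (x + t • u) u u) t) := by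
  have hl : ∀ t : ℝ, HasDerivAt (fun t : ℝ => x + t • u) u t := fun t => by
    simpa using ((hasDerivAt_id t).smul_const u).const_add x
  have hD : Differentiable ℝ V := hV.differentiable (by norm_num)
  have hD2 : Differentiable ℝ (fderiv ℝ V) :=
    (hV.fderiv_right (m := 1) (by norm_num)).differentiable (by norm_num)
  refine ⟨fun t => (hD _).hasFDerivAt.comp_hasDerivAt t (hl t), fun t => ?_⟩
  have := (hD2 (x + t • u)).hasFDerivAt.comp_hasDerivAt t (hl t)
  have h2 := this.clm_apply (hasDerivAt_const t u)
  simpa using h2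

lemma taylor_lower {d : ℕ} (V : EuclideanSpace ℝ (Fin d) → ℝ) (hV : ContDiff ℝ 2 V) (α : ℝ)
    (h : ∀ x, (hessianMatrix V x - α • 1).PosSemidef) (x u : EuclideanSpace ℝ (Fin d)) :
    V x + fderiv ℝ V x u + α * ‖u‖ ^ 2 / 2 ≤ V (x + u) := by
  have hl := line_derivs V hV x u
  have := taylor_one _ _ _ hl.1 hl.2 (α * ‖u‖ ^ 2) (fun t => hess_lower V α h _ u)
  simpa using this

lemma taylor_upper {d : ℕ} (V : EuclideanSpace ℝ (Fin d) → ℝ) (hV : ContDiff ℝ 2 V) (L : ℝ)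
    (h : ∀ x, ((L • 1 : Matrix (Fin d) (Fin d) ℝ) - hessianMatrix V x).PosSemidef)
    (x u : EuclideanSpace ℝ (Fin d)) :
    V (x + u) ≤ V x + fderiv ℝ V x u + L * ‖u‖ ^ 2 / 2 := by
  have hl := line_derivs V hV x u
  have := taylor_one _ _ _ (fun t => (hl.1 t).neg) (fun t => (hl.2 t).neg) (-(L * ‖u‖ ^ 2))
    (fun t => neg_le_neg (hess_upper V L h _ u))
  simp at this
  linarith

lemma lint_gamma {a c : ℝ} (ha : 0 < a) (hc : 0 < c) :
    ∫⁻ t in Set.Ioi (0 : ℝ), ENNReal.ofReal (t ^ (a - 1) * rexp (-(c * t))) =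
      ENNReal.ofReal (c ^ (-a) * Gamma a) := by
  have hint : IntegrableOn (fun t : ℝ => t ^ (a - 1) * rexp (-(c * t))) (Set.Ioi 0) := by
    have := integrableOn_rpow_mul_exp_neg_mul_rpow (p := 1) (s := a - 1) (by linarith)
      one_pos hc
    simpa using this
  rw [← ofReal_integral_eq_lintegral_ofReal hint, Real.integral_rpow_mul_exp_neg_mul_Ioi ha hc,
    one_div, Real.inv_rpow hc.le, Real.rpow_neg hc.le]
  refine (ae_restrict_iff' measurableSet_Ioi).2 (Filter.Eventually.of_forall fun t ht => ?_)
  have : (0:ℝ) < t := ht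
  show 0 ≤ t ^ (a - 1) * rexp (-(c * t))
  positivity

lemma lint_gauss {d : ℕ} {b : ℝ} (hb : 0 < b) :
    ∫⁻ x : EuclideanSpace ℝ (Fin d), ENNReal.ofReal (rexp (-b * ‖x‖ ^ 2)) =
      ENNReal.ofReal ((π / b) ^ ((d : ℝ) / 2)) := by
  have h := GaussianFourier.integral_rexp_neg_mul_sq_norm (V := EuclideanSpace ℝ (Fin d)) hb
  rw [finrank_euclideanSpace_fin] at h
  rw [← h, ofReal_integral_eq_lintegral_ofReal]
  · by_contra hn
    rw [integral_undef hn] at h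
    have : 0 < (π / b) ^ ((d : ℝ) / 2) := by positivity
    linarith
  · exact Filter.Eventually.of_forall fun x => (Real.exp_pos _).le

lemma lint_model {d : ℕ} {a c p : ℝ} (ha : 0 < a) (hc : 0 < c) (hp : (d : ℝ) / 2 < p) :
    ∫⁻ x : EuclideanSpace ℝ (Fin d), ENNReal.ofReal ((c + a * ‖x‖ ^ 2) ^ (-p)) =
      ENNReal.ofReal ((π / a) ^ ((d : ℝ) / 2) * c ^ ((d : ℝ) / 2 - p) *
        (Gamma (p - (d : ℝ) / 2) / Gamma p)) := by
  have hp0 : 0 < p := lt_of_le_of_lt (by positivity) hp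
  have hG : 0 < Gamma p := Gamma_pos_of_pos hp0
  have h1 : ∀ x : EuclideanSpace ℝ (Fin d), ENNReal.ofReal ((c + a * ‖x‖ ^ 2) ^ (-p)) =
      ENNReal.ofReal (Gamma p)⁻¹ * ∫⁻ t in Set.Ioi (0 : ℝ),
        ENNReal.ofReal (t ^ (p - 1) * rexp (-((c + a * ‖x‖ ^ 2) * t))) := fun x => by
    rw [lint_gamma hp0 (by positivity), ← ENNReal.ofReal_mul (by positivity)]
    congr 1
    field_simp
  simp_rw [h1]
  rw [lintegral_const_mul' _ _ ENNReal.ofReal_ne_top, lintegral_lintegral_swap]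
  · have h2 : ∫⁻ t in Set.Ioi (0 : ℝ), ∫⁻ x : EuclideanSpace ℝ (Fin d),
        ENNReal.ofReal (t ^ (p - 1) * rexp (-((c + a * ‖x‖ ^ 2) * t))) =
        ∫⁻ t in Set.Ioi (0 : ℝ), ENNReal.ofReal ((π / a) ^ ((d : ℝ) / 2)) *
          ENNReal.ofReal (t ^ ((p - (d : ℝ) / 2) - 1) * rexp (-(c * t))) := by
      refine setLIntegral_congr_fun measurableSet_Ioi fun t ht => ?_
      have ht : 0 < t := ht
      have h3 : ∀ x : EuclideanSpace ℝ (Fin d),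
          ENNReal.ofReal (t ^ (p - 1) * rexp (-((c + a * ‖x‖ ^ 2) * t))) =
          ENNReal.ofReal (t ^ (p - 1) * rexp (-(c * t))) *
            ENNReal.ofReal (rexp (-(a * t) * ‖x‖ ^ 2)) := fun x => by
        rw [← ENNReal.ofReal_mul (by positivity), mul_assoc, ← Real.exp_add]
        congr 3
        ring
      simp only [h3]
      rw [lintegral_const_mul' _ _ ENNReal.ofReal_ne_top, lint_gauss (by positivity),
        ← ENNReal.ofReal_mul (by positivity), ← ENNReal.ofReal_mul (by positivity)]
      congr 1
      rw [show p - (d : ℝ) / 2 - 1 = (p - 1) - (d : ℝ) / 2 by ring, Real.rpow_sub ht (p - 1) ((d : ℝ) / 2),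
        ← div_div, Real.div_rpow (by positivity) ht.le]
      field_simp
    rw [h2, lintegral_const_mul' _ _ ENNReal.ofReal_ne_top, lint_gamma (by linarith) hc,
      ← ENNReal.ofReal_mul (by positivity), ← ENNReal.ofReal_mul (by positivity)]
    congr 1
    rw [neg_sub]
    field_simp
  · apply Measurable.aemeasurable
    apply ENNReal.measurable_ofReal.comp
    show Measurable (fun z : EuclideanSpace ℝ (Fin d) × ℝ =>
      z.2 ^ (p - 1) * rexp (-((c + a * ‖z.1‖ ^ 2) * z.2)))
    fun_prop

lemma model_integrable {d : ℕ} {a c p : ℝ} (ha : 0 < a) (hc : 0 < c) (hp : (d : ℝ) / 2 < p) :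
    Integrable (fun x : EuclideanSpace ℝ (Fin d) => (c + a * ‖x‖ ^ 2) ^ (-p)) := by
  refine ⟨Measurable.aestronglyMeasurable (by fun_prop), ?_⟩
  rw [hasFiniteIntegral_iff_ofReal, lint_model ha hc hp]
  · exact ENNReal.ofReal_lt_top
  · exact Filter.Eventually.of_forall fun x => by positivity

lemma model_integral {d : ℕ} {a c p : ℝ} (ha : 0 < a) (hc : 0 < c) (hp : (d : ℝ) / 2 < p) :
    ∫ x : EuclideanSpace ℝ (Fin d), (c + a * ‖x‖ ^ 2) ^ (-p) =
      (π / a) ^ ((d : ℝ) / 2) * c ^ ((d : ℝ) / 2 - p) *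
        (Gamma (p - (d : ℝ) / 2) / Gamma p) := by
  have hp0 : 0 < p := lt_of_le_of_lt (by positivity) hp
  have h1 : 0 < Gamma p := Gamma_pos_of_pos hp0
  have h2 : 0 < Gamma (p - (d : ℝ) / 2) := Gamma_pos_of_pos (by linarith)
  rw [integral_eq_lintegral_of_nonneg_ae (Filter.Eventually.of_forall fun x => by positivity)
    (model_integrable ha hc hp).1, lint_model ha hc hp, ENNReal.toReal_ofReal (by positivity)]

lemma V_bounds {d : ℕ} (V : EuclideanSpace ℝ (Fin d) → ℝ) (hV : ContDiff ℝ 2 V) (α L : ℝ)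
    (hstrong : ∀ x, (hessianMatrix V x - α • 1).PosSemidef)
    (hlip : ∀ x, ((L • 1 : Matrix (Fin d) (Fin d) ℝ) - hessianMatrix V x).PosSemidef)
    (hmin : ∀ x, V 0 ≤ V x) (x : EuclideanSpace ℝ (Fin d)) :
    V 0 + α / 2 * ‖x‖ ^ 2 ≤ V x ∧ V x ≤ V 0 + L / 2 * ‖x‖ ^ 2 := by
  have h0 : fderiv ℝ V 0 = 0 :=
    IsLocalMin.fderiv_eq_zero (Filter.Eventually.of_forall hmin)
  have h1 := taylor_lower V hV α hstrong 0 x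
  have h2 := taylor_upper V hV L hlip 0 x
  simp [h0] at h1 h2
  constructor <;> linarith

lemma V_integrable {d : ℕ} (V : EuclideanSpace ℝ (Fin d) → ℝ) (hc : Continuous V)
    (hVpos : ∀ x, 0 < V x) {α : ℝ} (hα : 0 < α)
    (hb : ∀ x, V 0 + α / 2 * ‖x‖ ^ 2 ≤ V x) {p : ℝ} (hp : (d : ℝ) / 2 < p) :
    Integrable (fun x => V x ^ (-p)) := by
  have hp0 : 0 < p := lt_of_le_of_lt (by positivity) hp
  refine (model_integrable (a := α / 2) (c := V 0) (by positivity) (hVpos 0) hp).mono'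
    (hc.rpow_const fun x => Or.inl (hVpos x).ne').aestronglyMeasurable
    (Filter.Eventually.of_forall fun x => ?_)
  rw [Real.norm_of_nonneg (Real.rpow_nonneg (hVpos x).le _)]
  have := hVpos 0
  exact Real.rpow_le_rpow_of_nonpos (by positivity) (hb x) (by linarith)

lemma grad_sq {d : ℕ} (V : EuclideanSpace ℝ (Fin d) → ℝ) (hV : ContDiff ℝ 2 V)
    (hVpos : ∀ x, 0 < V x) {L : ℝ} (hL : 0 < L)
    (hlip : ∀ x, ((L • 1 : Matrix (Fin d) (Fin d) ℝ) - hessianMatrix V x).PosSemidef)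
    (x : EuclideanSpace ℝ (Fin d)) (i : Fin d) :
    (fderiv ℝ V x (EuclideanSpace.single i 1)) ^ 2 ≤ 2 * L * V x := by
  set D := fderiv ℝ V x (EuclideanSpace.single i 1) with hD
  have h := taylor_upper V hV L hlip x ((-(D / L)) • EuclideanSpace.single i 1)
  have h0 := hVpos (x + (-(D / L)) • EuclideanSpace.single i 1)
  rw [map_smul, ← hD, norm_smul] at h
  simp only [EuclideanSpace.norm_single, norm_one, mul_one, smul_eq_mul, Real.norm_eq_abs,
    sq_abs] at h
  have h2 : V x + -(D / L) * D + L * (-(D / L)) ^ 2 / 2 = V x - D ^ 2 / (2 * L) := by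
    field_simp; ring
  rw [h2] at h
  have h3 : D ^ 2 / (2 * L) ≤ V x := by linarith
  rw [div_le_iff₀ (by positivity)] at h3
  linarith

lemma ibp_eps {d : ℕ} (V : EuclideanSpace ℝ (Fin d) → ℝ) (hV : ContDiff ℝ 2 V)
    (hVpos : ∀ x, 0 < V x) {α L : ℝ} (hα : 0 < α) (hL : 0 < L)
    (hstrong : ∀ x, (hessianMatrix V x - α • 1).PosSemidef)
    (hlip : ∀ x, ((L • 1 : Matrix (Fin d) (Fin d) ℝ) - hessianMatrix V x).PosSemidef)
    {q : ℝ} (hq : 0 < q) (hint : Integrable (fun x => V x ^ (-q))) (i : Fin d)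
    {ε : ℝ} (hε : 0 < ε) :
    ∫ x, V x ^ (-q) * rexp (-(ε * V x)) *
      ((fderiv ℝ V x (EuclideanSpace.single i 1)) ^ 2 / V x) ≤ L / q * ∫ x, V x ^ (-q) := by
  set v : EuclideanSpace ℝ (Fin d) := EuclideanSpace.single i 1 with hv
  have hvn : ‖v‖ = 1 := by simp [hv]
  have hDV : Differentiable ℝ V := hV.differentiable (by norm_num)
  have hC1 : ContDiff ℝ 1 (fderiv ℝ V) := hV.fderiv_right (m := 1) (by norm_num)
  have hD2 : Differentiable ℝ (fderiv ℝ V) := hC1.differentiable (by norm_num)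
  have hcV : Continuous V := hV.continuous
  have hcD : Continuous (fun x => fderiv ℝ V x v) := hC1.continuous.clm_apply continuous_const
  have hgsq : ∀ x, (fderiv ℝ V x v) ^ 2 ≤ 2 * L * V x := fun x => grad_sq V hV hVpos hL hlip x i
  -- general integrability
  have key : ∀ (h : EuclideanSpace ℝ (Fin d) → ℝ) (A B : ℝ), 0 ≤ B → Continuous h →
      (∀ x, |h x| ≤ A + B * V x) →
      Integrable (fun x => V x ^ (-q) * rexp (-(ε * V x)) * h x) := by
    intro h A B hB hch hh
    refine (hint.const_mul (|A| + B / ε)).mono' ?_ (Filter.Eventually.of_forall fun x => ?_)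
    · exact (((hcV.rpow_const fun x => Or.inl (hVpos x).ne').mul (by fun_prop)).mul
        hch).aestronglyMeasurable
    · have hx := hVpos x
      have e1 : rexp (-(ε * V x)) ≤ 1 := Real.exp_le_one_iff.2 (by
        have : 0 < ε * V x := by positivity
        linarith)
      have e2 : V x * rexp (-(ε * V x)) ≤ 1 / ε := by
        have := Real.add_one_le_exp (ε * V x)
        rw [Real.exp_neg, ← div_eq_mul_inv, div_le_div_iff₀ (Real.exp_pos _) hε]
        linarith
      have e0 := Real.exp_pos (-(ε * V x))
      rw [norm_mul, norm_mul, Real.norm_of_nonneg (Real.rpow_nonneg hx.le _),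
        Real.norm_of_nonneg e0.le, Real.norm_eq_abs, mul_assoc, mul_comm]
      refine mul_le_mul_of_nonneg_right ?_ (Real.rpow_nonneg hx.le _)
      calc rexp (-(ε * V x)) * |h x| ≤ rexp (-(ε * V x)) * (|A| + B * V x) :=
            mul_le_mul_of_nonneg_left ((hh x).trans (by linarith [le_abs_self A])) e0.le
        _ = rexp (-(ε * V x)) * |A| + B * (V x * rexp (-(ε * V x))) := by ring
        _ ≤ 1 * |A| + B * (1 / ε) := by gcongr
        _ = _ := by ring
  have hg' : ∀ x, fderiv ℝ (fun x => fderiv ℝ V x v) x v = fderiv ℝ (fderiv ℝ V) x v v := by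
    intro x
    have := ((hD2 x).hasFDerivAt.clm_apply (hasFDerivAt_const v x)).fderiv
    rw [this]
    simp
  have hHess : ∀ x, 0 ≤ fderiv ℝ (fderiv ℝ V) x v v ∧ fderiv ℝ (fderiv ℝ V) x v v ≤ L := by
    intro x
    have h1 := hess_lower V α hstrong x v
    have h2 := hess_upper V L hlip x v
    rw [hvn] at h1 h2
    constructor <;> linarith
  have hcH : Continuous (fun x => fderiv ℝ (fderiv ℝ V) x v v) :=
    ((hC1.continuous_fderiv (by norm_num)).clm_apply continuous_const).clm_apply continuous_const
  have hfd : ∀ x, HasFDerivAt (fun x => V x ^ (-q) * rexp (-(ε * V x)))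
      ((-(V x ^ (-q) * rexp (-(ε * V x)) * (q / V x + ε))) • fderiv ℝ V x) x := by
    intro x
    have hx := hVpos x
    have hφ : HasDerivAt (fun y : ℝ => y ^ (-q) * rexp (-(ε * y)))
        (-(V x ^ (-q) * rexp (-(ε * V x)) * (q / V x + ε))) (V x) := by
      have h1 := Real.hasDerivAt_rpow_const (x := V x) (p := -q) (Or.inl hx.ne')
      have h2 := (((hasDerivAt_id (V x)).const_mul ε).neg).exp
      convert! h1.mul h2 using 1
      rw [Real.rpow_sub_one hx.ne']
      simp
      field_simp
      ring
    exact hφ.comp_hasFDerivAt x (hDV x).hasFDerivAt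
  have hI1 : Integrable (fun x => V x ^ (-q) * rexp (-(ε * V x)) *
      ((q / V x + ε) * (fderiv ℝ V x v) ^ 2)) := by
    refine key _ (2 * L * q) (2 * L * ε) (by positivity) ?_ ?_
    · exact ((continuous_const.div hcV fun x => (hVpos x).ne').add continuous_const).mul
        (hcD.pow 2)
    · intro x
      have hx := hVpos x
      rw [abs_of_nonneg (by positivity)]
      calc (q / V x + ε) * (fderiv ℝ V x v) ^ 2 ≤ (q / V x + ε) * (2 * L * V x) :=
            mul_le_mul_of_nonneg_left (hgsq x) (by positivity)
        _ = _ := by field_simp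
  have hI2 : Integrable (fun x => V x ^ (-q) * rexp (-(ε * V x)) *
      fderiv ℝ (fderiv ℝ V) x v v) := by
    refine key _ L 0 le_rfl hcH fun x => ?_
    rw [abs_of_nonneg (hHess x).1]
    linarith [(hHess x).2]
  have hI3 : Integrable (fun x => V x ^ (-q) * rexp (-(ε * V x)) * fderiv ℝ V x v) := by
    refine key _ 1 (2 * L) (by positivity) hcD fun x => ?_
    have := hgsq x
    rw [← sq_abs] at this
    nlinarith [sq_nonneg (|fderiv ℝ V x v| - 1)]
  have hI4 : Integrable (fun x => V x ^ (-q) * rexp (-(ε * V x)) *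
      ((fderiv ℝ V x v) ^ 2 / V x)) := by
    refine key _ (2 * L) 0 le_rfl ((hcD.pow 2).div hcV fun x => (hVpos x).ne') fun x => ?_
    have hx := hVpos x
    rw [abs_of_nonneg (by positivity), div_le_iff₀ hx]
    simpa using hgsq x
  have hibp := integral_mul_fderiv_eq_neg_fderiv_mul_of_integrable (μ := volume)
    (f := fun x => V x ^ (-q) * rexp (-(ε * V x))) (g := fun x => fderiv ℝ V x v) (v := v)
    (by
      refine hI1.neg.congr (Filter.Eventually.of_forall fun x => ?_)
      simp only [(hfd x).fderiv, Pi.neg_apply]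
      simp
      ring)
    (by simpa only [hg'] using hI2) hI3 (fun x _ => (hfd x).differentiableAt)
    (fun x _ => (hD2 x).clm_apply (differentiableAt_const v))
  have e1 : -∫ x, fderiv ℝ (fun x => V x ^ (-q) * rexp (-(ε * V x))) x v * fderiv ℝ V x v =
      ∫ x, V x ^ (-q) * rexp (-(ε * V x)) * ((q / V x + ε) * (fderiv ℝ V x v) ^ 2) := by
    rw [← integral_neg]
    refine integral_congr_ae (Filter.Eventually.of_forall fun x => ?_)
    simp only [(hfd x).fderiv]
    simp
    ring
  rw [e1] at hibp
  simp only [hg'] at hibp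
  have e2 : ∫ x, V x ^ (-q) * rexp (-(ε * V x)) * fderiv ℝ (fderiv ℝ V) x v v ≤
      ∫ x, L * V x ^ (-q) := by
    refine integral_mono hI2 (hint.const_mul L) fun x => ?_
    have hx := hVpos x
    have e1 : rexp (-(ε * V x)) ≤ 1 := Real.exp_le_one_iff.2 (by
        have : 0 < ε * V x := by positivity
        linarith)
    have e0 := Real.exp_pos (-(ε * V x))
    have h4 := hHess x
    have h5 : rexp (-(ε * V x)) * fderiv ℝ (fderiv ℝ V) x v v ≤ 1 * L :=
      mul_le_mul e1 h4.2 h4.1 zero_le_one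
    have h6 := mul_le_mul_of_nonneg_left h5 (Real.rpow_nonneg hx.le (-q))
    show V x ^ (-q) * rexp (-(ε * V x)) * fderiv ℝ (fderiv ℝ V) x v v ≤ L * V x ^ (-q)
    linarith
  have e3 : ∫ x, q * (V x ^ (-q) * rexp (-(ε * V x)) * ((fderiv ℝ V x v) ^ 2 / V x)) ≤
      ∫ x, V x ^ (-q) * rexp (-(ε * V x)) * ((q / V x + ε) * (fderiv ℝ V x v) ^ 2) := by
    refine integral_mono (hI4.const_mul q) hI1 fun x => ?_
    have hx := hVpos x
    have h7 : 0 ≤ V x ^ (-q) * rexp (-(ε * V x)) * (ε * (fderiv ℝ V x v) ^ 2) := by positivity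
    have h8 : V x ^ (-q) * rexp (-(ε * V x)) * ((q / V x + ε) * (fderiv ℝ V x v) ^ 2) =
      q * (V x ^ (-q) * rexp (-(ε * V x)) * ((fderiv ℝ V x v) ^ 2 / V x)) +
      V x ^ (-q) * rexp (-(ε * V x)) * (ε * (fderiv ℝ V x v) ^ 2) := by ring
    show q * (V x ^ (-q) * rexp (-(ε * V x)) * ((fderiv ℝ V x v) ^ 2 / V x)) ≤
      V x ^ (-q) * rexp (-(ε * V x)) * ((q / V x + ε) * (fderiv ℝ V x v) ^ 2)
    rw [h8]
    linarith
  rw [integral_const_mul] at e2 e3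
  rw [div_mul_eq_mul_div, le_div_iff₀ hq]
  linarith

lemma ibp_lim {d : ℕ} (V : EuclideanSpace ℝ (Fin d) → ℝ) (hV : ContDiff ℝ 2 V)
    (hVpos : ∀ x, 0 < V x) {α L : ℝ} (hα : 0 < α) (hL : 0 < L)
    (hstrong : ∀ x, (hessianMatrix V x - α • 1).PosSemidef)
    (hlip : ∀ x, ((L • 1 : Matrix (Fin d) (Fin d) ℝ) - hessianMatrix V x).PosSemidef)
    {q : ℝ} (hq : 0 < q) (hint : Integrable (fun x => V x ^ (-q))) (i : Fin d) :
    Integrable (fun x => V x ^ (-q) * ((fderiv ℝ V x (EuclideanSpace.single i 1)) ^ 2 / V x)) ∧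
    ∫ x, V x ^ (-q) * ((fderiv ℝ V x (EuclideanSpace.single i 1)) ^ 2 / V x) ≤
      L / q * ∫ x, V x ^ (-q) := by
  have hC1 : ContDiff ℝ 1 (fderiv ℝ V) := hV.fderiv_right (m := 1) (by norm_num)
  have hcV : Continuous V := hV.continuous
  have hcD : Continuous (fun x => fderiv ℝ V x (EuclideanSpace.single i 1)) :=
    hC1.continuous.clm_apply continuous_const
  have hcp : Continuous (fun x => V x ^ (-q)) := hcV.rpow_const fun x => Or.inl (hVpos x).ne'
  have hcq : Continuous (fun x => (fderiv ℝ V x (EuclideanSpace.single i 1)) ^ 2 / V x) :=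
    (hcD.pow 2).div hcV fun x => (hVpos x).ne'
  have hle : ∀ x, (fderiv ℝ V x (EuclideanSpace.single i 1)) ^ 2 / V x ≤ 2 * L := fun x => by
    rw [div_le_iff₀ (hVpos x)]
    exact grad_sq V hV hVpos hL hlip x i
  have hnn : ∀ x, 0 ≤ (fderiv ℝ V x (EuclideanSpace.single i 1)) ^ 2 / V x := fun x => by
    have := hVpos x
    positivity
  have hpn : ∀ x, 0 ≤ V x ^ (-q) := fun x => Real.rpow_nonneg (hVpos x).le _
  refine ⟨(hint.const_mul (2 * L)).mono' (hcp.mul hcq).aestronglyMeasurable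
    (Filter.Eventually.of_forall fun x => ?_), ?_⟩
  · rw [Real.norm_of_nonneg (mul_nonneg (hpn x) (hnn x)), mul_comm]
    exact mul_le_mul_of_nonneg_right (hle x) (hpn x)
  have hlim : Filter.Tendsto (fun n : ℕ => ∫ x, V x ^ (-q) * rexp (-((1 / ((n : ℝ) + 1)) * V x)) *
      ((fderiv ℝ V x (EuclideanSpace.single i 1)) ^ 2 / V x)) Filter.atTop
      (nhds (∫ x, V x ^ (-q) * ((fderiv ℝ V x (EuclideanSpace.single i 1)) ^ 2 / V x))) := by
    refine tendsto_integral_of_dominated_convergence (fun x => 2 * L * V x ^ (-q)) (fun n => ?_)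
      (hint.const_mul (2 * L)) (fun n => Filter.Eventually.of_forall fun x => ?_)
      (Filter.Eventually.of_forall fun x => ?_)
    · exact ((hcp.mul (by fun_prop)).mul hcq).aestronglyMeasurable
    · have hx := hVpos x
      have e1 : rexp (-((1 / ((n : ℝ) + 1)) * V x)) ≤ 1 := Real.exp_le_one_iff.2 (by
        have : 0 < (1 / ((n : ℝ) + 1)) * V x := by positivity
        linarith)
      have e0 := Real.exp_pos (-((1 / ((n : ℝ) + 1)) * V x))
      rw [Real.norm_of_nonneg (mul_nonneg (mul_nonneg (hpn x) e0.le) (hnn x)), mul_assoc, mul_comm]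
      refine mul_le_mul_of_nonneg_right ?_ (hpn x)
      have := mul_le_mul e1 (hle x) (hnn x) zero_le_one
      linarith
    · have h1 : Filter.Tendsto (fun n : ℕ => rexp (-((1 / ((n : ℝ) + 1)) * V x))) Filter.atTop
          (nhds (rexp (-(0 * V x)))) :=
        (Real.continuous_exp.tendsto _).comp
          ((tendsto_one_div_add_atTop_nhds_zero_nat.mul_const (V x)).neg)
      have := (h1.const_mul (V x ^ (-q))).mul_const
        ((fderiv ℝ V x (EuclideanSpace.single i 1)) ^ 2 / V x)
      simpa using this
  exact le_of_tendsto' hlim fun n =>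
    ibp_eps V hV hVpos hα hL hstrong hlip hq hint i (by positivity)

lemma grad_norm_sq {d : ℕ} (V : EuclideanSpace ℝ (Fin d) → ℝ) (x : EuclideanSpace ℝ (Fin d)) :
    ‖gradient V x‖ ^ 2 = ∑ i, (fderiv ℝ V x (EuclideanSpace.single i 1)) ^ 2 := by
  rw [EuclideanSpace.norm_sq_eq]
  refine Finset.sum_congr rfl fun i _ => ?_
  have h : inner ℝ (gradient V x) (EuclideanSpace.single i 1) =
      fderiv ℝ V x (EuclideanSpace.single i 1) := InnerProductSpace.toDual_symm_apply
  rw [← h, EuclideanSpace.inner_single_right]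
  simp

/-- Moment bounds in the general strongly-convex case: for `β > d/2 + 1`, `V`
positive, `α`-strongly convex, `L`-gradient Lipschitz with minimum at `0`, and
`r ∈ (0, β − d/2 − 1)`:
`∫ V dπ_β ≤ (L/α)^{(d/2)/(β−d/2−r)} V(0) (Γ(β)Γ(r)/(Γ(d/2+r)Γ(β−d/2)))^{1/(β−d/2−r)}`
and `∫ |∇V|² dπ_β ≤ (dL/(β−1))` times the same quantity. -/
theorem general_moment_bounds
    (d : ℕ) (hd : 1 ≤ d) (β : ℝ) (hβ : (d : ℝ) / 2 + 1 < β)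
    (V : EuclideanSpace ℝ (Fin d) → ℝ)
    (hV : ContDiff ℝ 2 V) (hVpos : ∀ x, 0 < V x)
    (α L : ℝ) (hα : 0 < α) (hL : 0 < L)
    (hstrong : ∀ x, (hessianMatrix V x - α • 1).PosSemidef)
    (hlip : ∀ x, ((L • 1 : Matrix (Fin d) (Fin d) ℝ) - hessianMatrix V x).PosSemidef)
    (hmin : ∀ x, V 0 ≤ V x)
    (Zβ : ℝ) (hZβ : Zβ = ∫ x, V x ^ (-β))
    (πβ : EuclideanSpace ℝ (Fin d) → ℝ)
    (hπβ : ∀ x, πβ x = Zβ⁻¹ * V x ^ (-β))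
    (r : ℝ) (hr0 : 0 < r) (hr1 : r < β - (d : ℝ) / 2 - 1) :
    (∫ x, V x * πβ x) ≤ (L / α) ^ (((d : ℝ) / 2) / (β - (d : ℝ) / 2 - r)) * V 0 *
      ((Real.Gamma β * Real.Gamma r) /
        (Real.Gamma ((d : ℝ) / 2 + r) * Real.Gamma (β - (d : ℝ) / 2)))
          ^ (1 / (β - (d : ℝ) / 2 - r)) ∧
    (∫ x, ‖gradient V x‖ ^ 2 * πβ x) ≤ ((d : ℝ) * L / (β - 1)) *
      ((L / α) ^ (((d : ℝ) / 2) / (β - (d : ℝ) / 2 - r)) * V 0 *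
        ((Real.Gamma β * Real.Gamma r) /
          (Real.Gamma ((d : ℝ) / 2 + r) * Real.Gamma (β - (d : ℝ) / 2)))
            ^ (1 / (β - (d : ℝ) / 2 - r))) := by
  have hp0 := hVpos 0
  have hd0 : 0 ≤ (d : ℝ) / 2 := by positivity
  have hB := V_bounds V hV α L hstrong hlip hmin
  have hcV : Continuous V := hV.continuous
  have hI : ∀ p : ℝ, (d : ℝ) / 2 < p → Integrable (fun x => V x ^ (-p)) := fun p hp =>
    V_integrable V hcV hVpos hα (fun x => (hB x).1) hp
  have hG1 : 0 < Real.Gamma β := Gamma_pos_of_pos (by linarith)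
  have hG2 : 0 < Real.Gamma r := Gamma_pos_of_pos hr0
  have hG3 : 0 < Real.Gamma ((d : ℝ) / 2 + r) := Gamma_pos_of_pos (by linarith)
  have hG4 : 0 < Real.Gamma (β - (d : ℝ) / 2) := Gamma_pos_of_pos (by linarith)
  set s := β - (d : ℝ) / 2 - r with hs
  have hs1 : 1 < s := by linarith
  have hs0 : 0 < s := by linarith
  set G := (Real.Gamma β * Real.Gamma r) /
        (Real.Gamma ((d : ℝ) / 2 + r) * Real.Gamma (β - (d : ℝ) / 2)) with hG
  have hGpos : 0 < G := by positivity
  set K := (L / α) ^ (((d : ℝ) / 2) / s) * V 0 * G ^ (1 / s) with hK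
  have hKpos : 0 < K := by positivity
  have hKs : K ^ s = (L / α) ^ ((d : ℝ) / 2) * V 0 ^ s * G := by
    rw [hK, Real.mul_rpow (by positivity) (by positivity),
      Real.mul_rpow (by positivity) (by positivity), ← Real.rpow_mul (by positivity),
      ← Real.rpow_mul (by positivity), div_mul_cancel₀ _ hs0.ne', div_mul_cancel₀ _ hs0.ne',
      Real.rpow_one]
  -- lower bound for the normalising constant
  have hZlow : (π / (L / 2)) ^ ((d : ℝ) / 2) * V 0 ^ ((d : ℝ) / 2 - β) *
      (Real.Gamma (β - (d : ℝ) / 2) / Real.Gamma β) ≤ Zβ := by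
    rw [← model_integral (by positivity) hp0 (by linarith), hZβ]
    refine integral_mono (model_integrable (by positivity) hp0 (by linarith))
      (hI β (by linarith)) fun x => ?_
    exact Real.rpow_le_rpow_of_nonpos (hVpos x) (hB x).2 (by linarith)
  have hZpos : 0 < Zβ := lt_of_lt_of_le (by positivity) hZlow
  have hup : ∫ x, V x ^ (-((d : ℝ) / 2 + r)) ≤ (π / (α / 2)) ^ ((d : ℝ) / 2) *
      V 0 ^ ((d : ℝ) / 2 - ((d : ℝ) / 2 + r)) *
      (Real.Gamma ((d : ℝ) / 2 + r - (d : ℝ) / 2) / Real.Gamma ((d : ℝ) / 2 + r)) := by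
    rw [← model_integral (by positivity) hp0 (by linarith)]
    refine integral_mono (hI _ (by linarith))
      (model_integrable (by positivity) hp0 (by linarith)) fun x => ?_
    exact Real.rpow_le_rpow_of_nonpos (by positivity) (hB x).1 (by linarith)
  have hmom : ∫ x, V x ^ (-((d : ℝ) / 2 + r)) ≤ K ^ s * Zβ := by
    refine hup.trans (le_trans (le_of_eq ?_)
      (mul_le_mul_of_nonneg_left hZlow (Real.rpow_nonneg hKpos.le _)))
    rw [hKs, hG, add_sub_cancel_left, show (d : ℝ) / 2 - ((d : ℝ) / 2 + r) =
      s + ((d : ℝ) / 2 - β) by rw [hs]; ring, Real.rpow_add hp0,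
      show π / (α / 2) = (L / α) * (π / (L / 2)) by field_simp,
      Real.mul_rpow (by positivity) (by positivity)]
    have hg4 := hG4.ne'
    generalize Real.Gamma (β - (d : ℝ) / 2) = g4 at hg4 ⊢
    field_simp
  -- Jensen
  have hJ : ∫ x, V x ^ (-(β - 1)) ≤ K * Zβ := by
    have hpt : ∀ x, V x ^ (-(β - 1)) ≤ K / s * (K ^ s)⁻¹ * V x ^ (-((d : ℝ) / 2 + r)) +
        K * (1 - 1 / s) * V x ^ (-β) := by
      intro x
      have hx := hVpos x
      have hb := one_add_mul_self_le_rpow_one_add (s := V x / K - 1)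
        (by have : 0 < V x / K := by positivity
            linarith) hs1.le
      rw [add_sub_cancel, Real.div_rpow hx.le hKpos.le] at hb
      have e1 : V x ^ (-(β - 1)) = V x * V x ^ (-β) := by
        rw [show -(β - 1) = -β + 1 by ring, Real.rpow_add_one hx.ne', mul_comm]
      have e2 : V x ^ (-((d : ℝ) / 2 + r)) = V x ^ s * V x ^ (-β) := by
        rw [← Real.rpow_add hx]
        congr 1
        rw [hs]; ring
      rw [e1, e2]
      have h3 : V x ≤ K / s * (K ^ s)⁻¹ * V x ^ s + K * (1 - 1 / s) := by
        have h4 := mul_le_mul_of_nonneg_left hb (show 0 ≤ K / s by positivity)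
        have h5 : K / s * (1 + s * (V x / K - 1)) = V x - K * (1 - 1 / s) := by
          field_simp; ring
        rw [h5] at h4
        have h6 : K / s * (V x ^ s / K ^ s) = K / s * (K ^ s)⁻¹ * V x ^ s := by ring
        linarith
      have := mul_le_mul_of_nonneg_right h3 (Real.rpow_nonneg hx.le (-β))
      linarith
    have hi1 := (hI ((d : ℝ) / 2 + r) (by linarith)).const_mul (K / s * (K ^ s)⁻¹)
    have hi2 := (hI β (by linarith)).const_mul (K * (1 - 1 / s))
    have h1 := integral_mono (hI (β - 1) (by linarith)) (hi1.add hi2) hpt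
    have h2 := integral_add hi1 hi2
    simp only [Pi.add_apply] at h1
    rw [h2, integral_const_mul, integral_const_mul, ← hZβ] at h1
    refine h1.trans ?_
    have hKsp : 0 < K ^ s := Real.rpow_pos_of_pos hKpos s
    have h3 := mul_le_mul_of_nonneg_left hmom (show 0 ≤ K / s * (K ^ s)⁻¹ by positivity)
    have h4 : K / s * (K ^ s)⁻¹ * (K ^ s * Zβ) = K / s * Zβ := by field_simp
    rw [h4] at h3
    calc _ ≤ K / s * Zβ + K * (1 - 1 / s) * Zβ := by linarith
      _ = K * Zβ := by ring
  have hJ' : Zβ⁻¹ * ∫ x, V x ^ (-(β - 1)) ≤ K := by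
    rw [inv_mul_le_iff₀ hZpos]
    linarith
  have hshift : ∀ x, V x ^ (-β) = V x ^ (-(β - 1)) / V x := fun x => by
    rw [← Real.rpow_sub_one (hVpos x).ne']
    congr 1; ring
  refine ⟨?_, ?_⟩
  · have : ∫ x, V x * πβ x = Zβ⁻¹ * ∫ x, V x ^ (-(β - 1)) := by
      rw [← integral_const_mul]
      refine integral_congr_ae (Filter.Eventually.of_forall fun x => ?_)
      have hx := hVpos x
      simp only [hπβ, hshift]
      field_simp
    rw [this]
    exact hJ'
  · have hq : 0 < β - 1 := by linarith
    have hib := fun i => ibp_lim V hV hVpos hα hL hstrong hlip hq (hI (β - 1) (by linarith)) i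
    have : ∫ x, ‖gradient V x‖ ^ 2 * πβ x = Zβ⁻¹ * ∑ i, ∫ x, V x ^ (-(β - 1)) *
        ((fderiv ℝ V x (EuclideanSpace.single i 1)) ^ 2 / V x) := by
      rw [← integral_finsetSum _ (fun i _ => (hib i).1), ← integral_const_mul]
      refine integral_congr_ae (Filter.Eventually.of_forall fun x => ?_)
      simp only [hπβ, hshift, grad_norm_sq, Finset.mul_sum, Finset.sum_mul]
      refine Finset.sum_congr rfl fun i _ => ?_
      ring
    rw [this]
    have hsum := Finset.sum_le_sum fun i (_ : i ∈ Finset.univ) => (hib i).2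
    rw [Finset.sum_const, Finset.card_univ, Fintype.card_fin, nsmul_eq_mul] at hsum
    have h1 := mul_le_mul_of_nonneg_left hsum (inv_nonneg.2 hZpos.le)
    have h2 := mul_le_mul_of_nonneg_left hJ' (show 0 ≤ (d : ℝ) * L / (β - 1) by positivity)
    refine h1.trans (le_trans (le_of_eq ?_) h2)
    ring
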